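/- Under the stated setup, there is a unique real number s̃ ∈ (e, t₁] satisfying ∫_{t₀}^{s̃} h₀(x) dx = V, and it is given explicitly by s̃ = s₀, where s₀ = e + ((n−1)g(e)/v)·( ( (n·v·(V − ∫_{t₀}^{e} g(x)dx) + (n−1)g(e)²) / ((n−1)g(e)²) )^{1/n} − 1 ) if v ≠ 0, and s₀ = e + (1/g(e))·(V − ∫_{t₀}^{e} g(x)dx) if v = 0. -/

import Mathlib

open MeasureTheory Set Filter

section BrunnMinkowski

open scoped Pointwise ENNReal

lemma Real.volume_add_volume_le_of_isCompact {K L C : Set ℝ} (hK : IsCompact K) (hL : IsCompact L)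
    (hK₀ : K.Nonempty) (hL₀ : L.Nonempty) (h : ∀ x ∈ K, ∀ y ∈ L, x + y ∈ C) :
    volume K + volume L ≤ volume C := by
  obtain ⟨M, hM, hMK⟩ := hK.exists_isGreatest hK₀
  obtain ⟨m, hm, hmL⟩ := hL.exists_isLeast hL₀
  have hK' : volume (m +ᵥ K) = volume K := measure_vadd _ _ _
  have hL' : volume (M +ᵥ L) = volume L := measure_vadd _ _ _
  have hd : AEDisjoint volume (m +ᵥ K) (M +ᵥ L) := by
    refine measure_mono_null (t := {M + m}) ?_ (by simp)
    rintro _ ⟨⟨x, hx, rfl⟩, ⟨y, hy, hxy⟩⟩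
    have h₁ := hMK hx
    have h₂ := hmL hy
    simp only [vadd_eq_add, mem_singleton_iff] at hxy ⊢
    linarith
  rw [← hK', ← hL', ← measure_union₀ (hL.vadd M).measurableSet.nullMeasurableSet hd]
  refine measure_mono (union_subset ?_ ?_)
  · rintro _ ⟨x, hx, rfl⟩
    simpa [add_comm] using h x hx m hm
  · rintro _ ⟨y, hy, rfl⟩
    exact h M hM y hy

/-- The one-dimensional Brunn–Minkowski inequality. -/
lemma Real.volume_add_volume_le {A B C : Set ℝ} (hA : MeasurableSet A) (hB : MeasurableSet B)
    (hA₀ : A.Nonempty) (hB₀ : B.Nonempty) (h : ∀ x ∈ A, ∀ y ∈ B, x + y ∈ C) :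
    volume A + volume B ≤ volume C := by
  obtain ⟨p, hp⟩ := hA₀
  obtain ⟨q, hq⟩ := hB₀
  have key : ∀ K ⊆ A, IsCompact K → ∀ L ⊆ B, IsCompact L → volume K + volume L ≤ volume C := by
    intro K hKA hK L hLB hL
    refine le_trans (add_le_add (measure_mono (subset_insert p K))
      (measure_mono (subset_insert q L)))
      (volume_add_volume_le_of_isCompact (hK.insert p) (hL.insert q) (insert_nonempty _ _)
        (insert_nonempty _ _) fun x hx y hy => h x ?_ y ?_)
    · exact insert_subset hp hKA hx
    · exact insert_subset hq hLB hy
  have hCA : volume A ≤ volume C := by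
    rw [hA.measure_eq_iSup_isCompact]
    exact iSup₂_le fun K hKA => iSup_le fun hK => le_self_add.trans
      (key K hKA hK ∅ (empty_subset _) isCompact_empty)
  by_cases hA' : volume A = ∞
  · rw [hA', top_le_iff] at hCA
    simp [hCA]
  have hL' : ∀ L ⊆ B, IsCompact L → volume A + volume L ≤ volume C := by
    intro L hLB hL
    refine add_le_of_le_tsub_right_of_le ?_ ?_
    · simpa using key ∅ (empty_subset _) isCompact_empty L hLB hL
    · rw [hA.measure_eq_iSup_isCompact]
      exact iSup₂_le fun K hKA => iSup_le fun hK =>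
        ENNReal.le_sub_of_add_le_right hL.measure_lt_top.ne (key K hKA hK L hLB hL)
  refine add_le_of_le_tsub_left_of_le hCA ?_
  rw [hB.measure_eq_iSup_isCompact]
  exact iSup₂_le fun L hLB => iSup_le fun hL =>
    ENNReal.le_sub_of_add_le_left hA' (hL' L hLB hL)

lemma lintegral_eq_lintegral_meas_ofReal_lt {u : ℝ → ℝ≥0∞} (hu : Measurable u)
    (hu' : ∀ x, u x ≠ ∞) :
    ∫⁻ x, u x = ∫⁻ t in Ioi (0 : ℝ), volume {x | ENNReal.ofReal t < u x} := by
  have h := lintegral_eq_lintegral_meas_lt volume (f := fun x => (u x).toReal)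
    (ae_of_all _ fun x => ENNReal.toReal_nonneg) hu.ennreal_toReal.aemeasurable
  simp only [ENNReal.ofReal_toReal (hu' _)] at h
  rw [h]
  refine setLIntegral_congr_fun measurableSet_Ioi fun t ht => ?_
  simp only [ENNReal.ofReal_lt_iff_lt_toReal (le_of_lt ht) (hu' _)]

lemma ENNReal.rpow_mul_rpow_le_add {a b : ℝ} (ha : 0 < a) (hb : 0 < b) (hab : a + b = 1)
    (P Q : ℝ≥0∞) : P ^ a * Q ^ b ≤ ENNReal.ofReal a * P + ENNReal.ofReal b * Q := by
  have hpq : a⁻¹.HolderConjugate b⁻¹ := by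
    rw [Real.holderConjugate_iff]
    exact ⟨(one_lt_inv₀ ha).2 (by linarith), by simpa using hab⟩
  have h := ENNReal.young_inequality (P ^ a) (Q ^ b) hpq
  rw [← ENNReal.rpow_mul, ← ENNReal.rpow_mul, mul_inv_cancel₀ ha.ne', mul_inv_cancel₀ hb.ne',
    ENNReal.rpow_one, ENNReal.rpow_one, ENNReal.ofReal_inv_of_pos ha,
    ENNReal.ofReal_inv_of_pos hb, div_eq_mul_inv, div_eq_mul_inv, inv_inv, inv_inv] at h
  rwa [mul_comm P, mul_comm Q] at h

lemma add_lintegral_le_of_forall_lt {a b : ℝ} (ha : 0 < a) (hb : 0 < b) {u w h : ℝ → ℝ≥0∞}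
    (hu : Measurable u) (hw : Measurable w) (hh : Measurable h)
    (hu₁ : ∀ x, u x ≤ 1) (hw₁ : ∀ x, w x ≤ 1) (hh₁ : ∀ x, h x ≤ 1)
    (hu₂ : ∀ t < 1, ∃ x, t < u x) (hw₂ : ∀ t < 1, ∃ x, t < w x)
    (H : ∀ t x y, t < u x → t < w y → t < h (a * x + b * y)) :
    ENNReal.ofReal a * (∫⁻ x, u x) + ENNReal.ofReal b * (∫⁻ x, w x) ≤ ∫⁻ x, h x := by
  have hne : ∀ {f : ℝ → ℝ≥0∞}, (∀ x, f x ≤ 1) → ∀ x, f x ≠ ∞ :=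
    fun hf x => ((hf x).trans_lt ENNReal.one_lt_top).ne
  have hmeas : ∀ f : ℝ → ℝ≥0∞, Measurable fun t : ℝ => volume {x | ENNReal.ofReal t < f x} := by
    intro f
    refine Antitone.measurable fun s t hst => measure_mono fun x hx => ?_
    exact (ENNReal.ofReal_le_ofReal hst).trans_lt hx
  rw [lintegral_eq_lintegral_meas_ofReal_lt hu (hne hu₁),
    lintegral_eq_lintegral_meas_ofReal_lt hw (hne hw₁),
    lintegral_eq_lintegral_meas_ofReal_lt hh (hne hh₁), ← lintegral_const_mul _ (hmeas u),
    ← lintegral_const_mul _ (hmeas w), ← lintegral_add_left ((hmeas u).const_mul _)]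
  refine setLIntegral_mono (hmeas h) fun t ht => ?_
  rcases lt_or_ge (ENNReal.ofReal t) 1 with ht₁ | ht₁
  · have hs : ∀ {c : ℝ}, 0 < c → ∀ A : Set ℝ,
        ENNReal.ofReal c * volume A = volume (c • A) := fun hc A => by
      simp [Measure.addHaar_smul, abs_of_pos hc]
    rw [hs ha, hs hb]
    refine Real.volume_add_volume_le ((measurableSet_lt measurable_const hu).const_smul₀ a)
      ((measurableSet_lt measurable_const hw).const_smul₀ b)
      (Set.Nonempty.smul_set (hu₂ _ ht₁)) (Set.Nonempty.smul_set (hw₂ _ ht₁)) ?_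
    rintro _ ⟨x, hx, rfl⟩ _ ⟨y, hy, rfl⟩
    exact H _ x y hx hy
  · have h0 : ∀ {f : ℝ → ℝ≥0∞}, (∀ x, f x ≤ 1) → {x | ENNReal.ofReal t < f x} = ∅ :=
      fun hf => by
        ext x
        simpa using (hf x).trans ht₁
    simp [h0 hu₁, h0 hw₁]

lemma prekopaLeindler_real_of_iSup_ne_top {a b : ℝ} (ha : 0 < a) (hb : 0 < b) (hab : a + b = 1)
    {f g h : ℝ → ℝ≥0∞} (hf : Measurable f) (hg : Measurable g) (hh : Measurable h)
    (hf' : ⨆ x, f x ≠ ∞) (hg' : ⨆ x, g x ≠ ∞)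
    (H : ∀ x y, f x ^ a * g y ^ b ≤ h (a * x + b * y)) :
    (∫⁻ x, f x) ^ a * (∫⁻ x, g x) ^ b ≤ ∫⁻ x, h x := by
  set M := ⨆ x, f x with hM
  set N := ⨆ x, g x with hN
  by_cases hM0 : M = 0
  · simp [ENNReal.iSup_eq_zero.1 hM0, ha]
  by_cases hN0 : N = 0
  · simp [ENNReal.iSup_eq_zero.1 hN0, hb]
  have hMa : M ^ a ≠ 0 := by simp [hM0, hf']
  have hMa' : M ^ a ≠ ∞ := ENNReal.rpow_ne_top_of_nonneg ha.le hf'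
  have hNb : N ^ b ≠ 0 := by simp [hN0, hg']
  have hNb' : N ^ b ≠ ∞ := ENNReal.rpow_ne_top_of_nonneg hb.le hg'
  have hdiv : ∀ p q : ℝ≥0∞, (p / M) ^ a * (q / N) ^ b = p ^ a * q ^ b / (M ^ a * N ^ b) := by
    intro p q
    rw [ENNReal.div_rpow_of_nonneg _ _ ha.le, ENNReal.div_rpow_of_nonneg _ _ hb.le,
      ENNReal.mul_div_mul_comm (Or.inl hMa) (Or.inl hMa')]
  have key := add_lintegral_le_of_forall_lt ha hb (u := fun x => f x / M) (w := fun x => g x / N)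
    (h := fun x => min 1 (h x / (M ^ a * N ^ b))) (hf.div_const _) (hg.div_const _)
    (measurable_const.min (hh.div_const _))
    (fun x => ENNReal.div_le_of_le_mul (by simpa using le_iSup f x))
    (fun x => ENNReal.div_le_of_le_mul (by simpa using le_iSup g x))
    (fun x => min_le_left _ _) ?_ ?_ ?_
  · have h₁ := (ENNReal.rpow_mul_rpow_le_add ha hb hab _ _).trans key
    simp only [div_eq_mul_inv] at h₁
    rw [lintegral_mul_const _ hf, lintegral_mul_const _ hg, ← div_eq_mul_inv, ← div_eq_mul_inv,
      hdiv] at h₁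
    have h₂ := h₁.trans (lintegral_mono fun x => min_le_right _ _)
    rw [lintegral_mul_const _ hh, ← div_eq_mul_inv] at h₂
    rwa [ENNReal.div_le_iff (mul_ne_zero hMa hNb) (ENNReal.mul_ne_top hMa' hNb'),
      ENNReal.div_mul_cancel (mul_ne_zero hMa hNb) (ENNReal.mul_ne_top hMa' hNb')] at h₂
  · intro t ht
    obtain ⟨x, hx⟩ := lt_iSup_iff.1 (show t * M < ⨆ x, f x by
      simpa using ENNReal.mul_lt_mul_left hM0 hf' ht)
    exact ⟨x, by rwa [ENNReal.lt_div_iff_mul_lt (Or.inl hM0) (Or.inl hf')]⟩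
  · intro t ht
    obtain ⟨x, hx⟩ := lt_iSup_iff.1 (show t * N < ⨆ x, g x by
      simpa using ENNReal.mul_lt_mul_left hN0 hg' ht)
    exact ⟨x, by rwa [ENNReal.lt_div_iff_mul_lt (Or.inl hN0) (Or.inl hg')]⟩
  · intro t x y hx hy
    have hx1 : f x / M ≤ 1 := ENNReal.div_le_of_le_mul (by simpa using le_iSup f x)
    refine lt_min (hx.trans_le hx1) ?_
    calc t = t ^ a * t ^ b := by
          rw [← ENNReal.rpow_add_of_nonneg _ _ ha.le hb.le, hab, ENNReal.rpow_one]
      _ < (f x / M) ^ a * (g y / N) ^ b :=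
          ENNReal.mul_lt_mul (ENNReal.rpow_lt_rpow hx ha) (ENNReal.rpow_lt_rpow hy hb)
      _ ≤ _ := by
          rw [hdiv]
          exact ENNReal.div_le_div_right (H x y) _

/-- The one-dimensional Prékopa–Leindler inequality. -/
lemma prekopaLeindler_real {a b : ℝ} (ha : 0 < a) (hb : 0 < b) (hab : a + b = 1)
    {f g h : ℝ → ℝ≥0∞} (hf : Measurable f) (hg : Measurable g) (hh : Measurable h)
    (H : ∀ x y, f x ^ a * g y ^ b ≤ h (a * x + b * y)) :
    (∫⁻ x, f x) ^ a * (∫⁻ x, g x) ^ b ≤ ∫⁻ x, h x := by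
  have htr : ∀ {k : ℝ → ℝ≥0∞}, Measurable k →
      ∫⁻ x, k x = ⨆ n : ℕ, ∫⁻ x, min (k x) n := fun {k} hk => by
    rw [← lintegral_iSup (fun n => hk.min measurable_const)
      fun m n hmn x => min_le_min_left _ (by exact_mod_cast hmn)]
    refine lintegral_congr fun x => ?_
    rw [← inf_iSup_eq]
    simp [ENNReal.iSup_natCast]
  have hmono : ∀ k : ℝ → ℝ≥0∞, Monotone fun n : ℕ => ∫⁻ x, min (k x) n :=
    fun k m n hmn => lintegral_mono fun x => min_le_min_left _ (by exact_mod_cast hmn)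
  have hsup : ∀ (k : ℝ → ℝ≥0∞) (n : ℕ), ⨆ x, min (k x) n ≠ ∞ := fun k n =>
    ((iSup_le fun x => min_le_right _ _).trans_lt (ENNReal.natCast_lt_top n)).ne
  have hrpow : ∀ {c : ℝ}, 0 < c → ∀ k : ℕ → ℝ≥0∞, (⨆ n, k n) ^ c = ⨆ n, k n ^ c :=
    fun hc k => (ENNReal.orderIsoRpow _ hc).map_iSup k
  rw [htr hf, htr hg, hrpow ha, hrpow hb, ENNReal.iSup_mul]
  refine iSup_le fun m => ?_
  rw [ENNReal.mul_iSup]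
  refine iSup_le fun n => ?_
  refine le_trans (mul_le_mul' (ENNReal.rpow_le_rpow (hmono f (le_max_left m n)) ha.le)
    (ENNReal.rpow_le_rpow (hmono g (le_max_right m n)) hb.le)) ?_
  refine prekopaLeindler_real_of_iSup_ne_top ha hb hab (hf.min measurable_const)
    (hg.min measurable_const) hh (hsup f _) (hsup g _) fun x y => le_trans ?_ (H x y)
  exact mul_le_mul' (ENNReal.rpow_le_rpow (min_le_left _ _) ha.le)
    (ENNReal.rpow_le_rpow (min_le_left _ _) hb.le)

/-- The Prékopa–Leindler inequality. -/
theorem prekopaLeindler {a b : ℝ} (ha : 0 < a) (hb : 0 < b) (hab : a + b = 1) (d : ℕ)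
    {f g h : (Fin d → ℝ) → ℝ≥0∞} (hf : Measurable f) (hg : Measurable g) (hh : Measurable h)
    (H : ∀ x y, f x ^ a * g y ^ b ≤ h (a • x + b • y)) :
    (∫⁻ x, f x) ^ a * (∫⁻ x, g x) ^ b ≤ ∫⁻ x, h x := by
  induction d with
  | zero =>
    have hv : volume (univ : Set (Fin 0 → ℝ)) = 1 := by simp [volume_pi]
    simp only [lintegral_unique, hv, mul_one]
    convert H default default
  | succ d ih =>
    let e := MeasurableEquiv.piFinSuccAbove (fun _ : Fin (d + 1) => ℝ) 0
    have he : MeasurePreserving e volume volume :=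
      volume_preserving_piFinSuccAbove (fun _ : Fin (d + 1) => ℝ) 0
    have hfub : ∀ {k : (Fin (d + 1) → ℝ) → ℝ≥0∞}, Measurable k →
        ∫⁻ x, k x = ∫⁻ s, ∫⁻ y, k (e.symm (s, y)) := fun {k} hk => by
      rw [← he.symm.lintegral_comp_emb e.symm.measurableEmbedding, Measure.volume_eq_prod]
      exact lintegral_prod _ (hk.comp e.symm.measurable).aemeasurable
    have hmeas : ∀ {k : (Fin (d + 1) → ℝ) → ℝ≥0∞}, Measurable k →
        Measurable fun s => ∫⁻ y, k (e.symm (s, y)) := fun {k} hk =>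
      (hk.comp e.symm.measurable).lintegral_prod_right'
    have hsec : ∀ {k : (Fin (d + 1) → ℝ) → ℝ≥0∞}, Measurable k → ∀ s,
        Measurable fun y => k (e.symm (s, y)) := fun {k} hk s =>
      (hk.comp e.symm.measurable).comp measurable_prodMk_left
    rw [hfub hf, hfub hg, hfub hh]
    refine prekopaLeindler_real ha hb hab (hmeas hf) (hmeas hg) (hmeas hh) fun s t => ?_
    refine ih (hsec hf s) (hsec hg t) (hsec hh _) fun x y => (H _ _).trans_eq ?_
    congr 1
    ext i
    refine Fin.cases ?_ (fun j => ?_) i <;> simp [e, MeasurableEquiv.piFinSuccAbove]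

/-- The Brunn–Minkowski inequality. -/
theorem brunnMinkowski {a b : ℝ} (ha : 0 < a) (hb : 0 < b) {d : ℕ} (hd : d ≠ 0)
    {A B C : Set (Fin d → ℝ)} (hA : MeasurableSet A) (hB : MeasurableSet B) (hC : MeasurableSet C)
    (hA₀ : 0 < volume.real A) (hB₀ : 0 < volume.real B) (hC' : volume C ≠ ∞)
    (H : ∀ x ∈ A, ∀ y ∈ B, a • x + b • y ∈ C) :
    a * volume.real A ^ (d : ℝ)⁻¹ + b * volume.real B ^ (d : ℝ)⁻¹ ≤
      volume.real C ^ (d : ℝ)⁻¹ := by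
  set α := volume.real A ^ (d : ℝ)⁻¹ with hα
  set β := volume.real B ^ (d : ℝ)⁻¹ with hβ
  have hα₀ : 0 < α := Real.rpow_pos_of_pos hA₀ _
  have hβ₀ : 0 < β := Real.rpow_pos_of_pos hB₀ _
  have hαd : α ^ d = volume.real A := Real.rpow_inv_natCast_pow hA₀.le hd
  have hβd : β ^ d = volume.real B := Real.rpow_inv_natCast_pow hB₀.le hd
  set σ := a * α + b * β with hσ
  have hσ₀ : 0 < σ := by positivity
  have hscale : ∀ {c : ℝ}, 0 < c → ∀ S : Set (Fin d → ℝ),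
      volume.real (c⁻¹ • S) = volume.real S / c ^ d := fun {c} hc S => by
    rw [Measure.real, Measure.addHaar_smul, abs_of_pos (by positivity), Module.finrank_fin_fun,
      ENNReal.toReal_mul, ENNReal.toReal_ofReal (by positivity), inv_pow, ← Measure.real,
      inv_mul_eq_div]
  have hone : ∀ {c : ℝ} {S : Set (Fin d → ℝ)}, 0 < c → c ^ d = volume.real S →
      volume (c⁻¹ • S) = 1 := fun {c S} hc hS => by
    have h := hscale hc S
    rw [← hS, div_self (by positivity)] at h
    rwa [Measure.real, ENNReal.toReal_eq_one_iff] at h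
  have hPL := prekopaLeindler (a := a * α / σ) (b := b * β / σ) (by positivity) (by positivity)
    (by rw [← add_div, ← hσ, div_self hσ₀.ne']) d
    (f := (α⁻¹ • A).indicator 1) (g := (β⁻¹ • B).indicator 1) (h := (σ⁻¹ • C).indicator 1)
    (measurable_one.indicator (hA.const_smul₀ _)) (measurable_one.indicator (hB.const_smul₀ _))
    (measurable_one.indicator (hC.const_smul₀ _)) ?_
  · rw [lintegral_indicator_one (hA.const_smul₀ _), lintegral_indicator_one (hB.const_smul₀ _),
      lintegral_indicator_one (hC.const_smul₀ _), hone hα₀ hαd, hone hβ₀ hβd, ENNReal.one_rpow,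
      ENNReal.one_rpow, one_mul] at hPL
    have hfin : volume (σ⁻¹ • C) ≠ ∞ := by
      rw [Measure.addHaar_smul]
      exact ENNReal.mul_ne_top ENNReal.ofReal_ne_top hC'
    have h₁ : 1 ≤ volume.real (σ⁻¹ • C) := by
      simpa [Measure.real] using ENNReal.toReal_mono hfin hPL
    rw [hscale hσ₀, one_le_div (by positivity)] at h₁
    rw [Real.le_rpow_inv_iff_of_pos hσ₀.le measureReal_nonneg (by positivity), Real.rpow_natCast]
    exact h₁
  · intro x y
    by_cases hx : x ∈ α⁻¹ • A
    · by_cases hy : y ∈ β⁻¹ • B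
      · obtain ⟨x, hx, rfl⟩ := hx
        obtain ⟨y, hy, rfl⟩ := hy
        have hz : (a * α / σ) • α⁻¹ • x + (b * β / σ) • β⁻¹ • y ∈ σ⁻¹ • C := by
          refine ⟨a • x + b • y, H x hx y hy, ?_⟩
          simp only [smul_add, smul_smul]
          congr 2 <;> field_simp
        simp only [indicator_of_mem hz]
        exact (mul_le_mul' (ENNReal.rpow_le_rpow (indicator_le_self' (by simp) _) (by positivity))
          (ENNReal.rpow_le_rpow (indicator_le_self' (by simp) _) (by positivity))).trans (by simp)
      · rw [indicator_of_notMem hy, ENNReal.zero_rpow_of_pos (by positivity)]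
        simp
    · rw [indicator_of_notMem hx, ENNReal.zero_rpow_of_pos (by positivity)]
      simp

section Sections

variable {d : ℕ} {Δ : Set (ℝ × (Fin d → ℝ))}

lemma IsCompact.prodMk_preimage (hΔ : IsCompact Δ) (x : ℝ) :
    IsCompact {y : Fin d → ℝ | (x, y) ∈ Δ} := by
  have h : {y : Fin d → ℝ | (x, y) ∈ Δ} = Prod.snd '' (Δ ∩ Prod.fst ⁻¹' {x}) := by
    ext y
    simp
  rw [h]
  exact (hΔ.inter_right (isClosed_singleton.preimage continuous_fst)).image continuous_snd

lemma Convex.volume_section_pos (hΔ : Convex ℝ Δ) (hc : IsCompact Δ) (hi : (interior Δ).Nonempty)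
    {t₀ t₁ : ℝ} (hp : Prod.fst '' Δ = Icc t₀ t₁) {x : ℝ} (hx : x ∈ Ioo t₀ t₁) :
    0 < volume.real {y : Fin d → ℝ | (x, y) ∈ Δ} := by
  obtain ⟨p, hpi⟩ := hi
  have h01 : t₀ ≤ t₁ := (hx.1.trans hx.2).le
  obtain ⟨r₀, hr₀, hr₀'⟩ : t₀ ∈ Prod.fst '' Δ := hp ▸ left_mem_Icc.2 h01
  obtain ⟨r₁, hr₁, hr₁'⟩ : t₁ ∈ Prod.fst '' Δ := hp ▸ right_mem_Icc.2 h01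
  obtain ⟨r, hr, a, b, ha, hb, hab, hx'⟩ : ∃ r ∈ Δ, ∃ a b : ℝ,
      0 < a ∧ 0 ≤ b ∧ a + b = 1 ∧ a * p.1 + b * r.1 = x := by
    rcases le_total p.1 x with h | h
    · have hpos : 0 < t₁ - p.1 := by linarith [hx.2]
      refine ⟨r₁, hr₁, (t₁ - x) / (t₁ - p.1), (x - p.1) / (t₁ - p.1),
        div_pos (by linarith [hx.2]) hpos, div_nonneg (by linarith) hpos.le, ?_, ?_⟩
      · field_simp
        ring
      · rw [hr₁']
        field_simp
        ring
    · have hpos : 0 < p.1 - t₀ := by linarith [hx.1]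
      refine ⟨r₀, hr₀, (x - t₀) / (p.1 - t₀), (p.1 - x) / (p.1 - t₀),
        div_pos (by linarith [hx.1]) hpos, div_nonneg (by linarith) hpos.le, ?_, ?_⟩
      · field_simp
        ring
      · rw [hr₀']
        field_simp
        ring
  have hq := hΔ.combo_interior_self_mem_interior hpi hr ha hb hab
  have hopen : IsOpen {y : Fin d → ℝ | (x, y) ∈ interior Δ} :=
    isOpen_interior.preimage (Continuous.prodMk_right x)
  have hne : {y : Fin d → ℝ | (x, y) ∈ interior Δ}.Nonempty := by
    refine ⟨(a • p + b • r).2, ?_⟩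
    rw [mem_ofPred_eq, ← hx']
    exact hq
  refine ENNReal.toReal_pos ?_ (hc.prodMk_preimage x).measure_lt_top.ne
  exact ((hopen.measure_pos volume hne).trans_le
    (measure_mono fun y (hy : (x, y) ∈ interior Δ) => show (x, y) ∈ Δ from interior_subset hy)).ne'

/-- The volume of the sections of a convex body is `1 / d`-concave. -/
lemma Convex.concaveOn_volume_section_rpow (hΔ : Convex ℝ Δ) (hc : IsCompact Δ)
    (hi : (interior Δ).Nonempty) (hd : d ≠ 0) {t₀ t₁ : ℝ} (hp : Prod.fst '' Δ = Icc t₀ t₁) :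
    ConcaveOn ℝ (Ioo t₀ t₁)
      fun x => volume.real {y : Fin d → ℝ | (x, y) ∈ Δ} ^ (d : ℝ)⁻¹ := by
  rw [concaveOn_iff_forall_pos]
  refine ⟨convex_Ioo _ _, fun x hx y hy a b ha hb hab => ?_⟩
  refine brunnMinkowski ha hb hd (hc.prodMk_preimage x).measurableSet
    (hc.prodMk_preimage y).measurableSet (hc.prodMk_preimage _).measurableSet
    (hΔ.volume_section_pos hc hi hp hx) (hΔ.volume_section_pos hc hi hp hy)
    (hc.prodMk_preimage _).measure_lt_top.ne fun u hu w hw => ?_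
  exact hΔ hu hw ha.le hb.le hab

lemma IsCompact.integrable_volume_section (hc : IsCompact Δ) :
    Integrable fun x => volume.real {y : Fin d → ℝ | (x, y) ∈ Δ} :=
  Measure.integrable_measure_prodMk_left hc.measurableSet hc.measure_lt_top.ne

lemma IsCompact.integral_volume_section (hc : IsCompact Δ) {t₀ t₁ : ℝ} (h01 : t₀ ≤ t₁)
    (hp : Prod.fst '' Δ = Icc t₀ t₁) :
    ∫ x in t₀..t₁, volume.real {y : Fin d → ℝ | (x, y) ∈ Δ} = volume.real Δ := by
  have hzero : ∀ x ∉ Icc t₀ t₁, volume.real {y : Fin d → ℝ | (x, y) ∈ Δ} = 0 := by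
    intro x hx
    have : {y : Fin d → ℝ | (x, y) ∈ Δ} = ∅ := by
      ext y
      simp only [mem_ofPred_eq, mem_empty_iff_false, iff_false]
      exact fun hy => hx (hp ▸ ⟨_, hy, rfl⟩)
    simp [this]
  rw [intervalIntegral.integral_of_le h01, ← integral_Icc_eq_integral_Ioc,
    setIntegral_eq_integral_of_forall_compl_eq_zero hzero]
  have hfin : ∀ x : ℝ, volume {y : Fin d → ℝ | (x, y) ∈ Δ} < ∞ :=
    fun x => (hc.prodMk_preimage x).measure_lt_top
  refine (integral_toReal (measurable_measure_prodMk_left hc.measurableSet).aemeasurable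
    (ae_of_all _ hfin)).trans ?_
  rw [Measure.real, Measure.volume_eq_prod, Measure.prod_apply hc.measurableSet]

end Sections

/-- A function lying in the concave cone of exponent `1 / d` is bounded by the `d`-th power of its
one-sided tangent line. -/
lemma ConcaveOn.le_pow_of_tendsto_slope {d : ℕ} (hd : d ≠ 0) {g : ℝ → ℝ} {t₀ t₁ e v : ℝ}
    (he : e ∈ Ioo t₀ t₁) (hpos : ∀ x ∈ Ioo t₀ t₁, 0 < g x)
    (hg : ConcaveOn ℝ (Ioo t₀ t₁) fun x => g x ^ (d : ℝ)⁻¹)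
    (hv : Tendsto (fun x => (g x - g e) / (x - e)) (nhdsWithin e (Ioi e)) (nhds v)
        ∨ Tendsto (fun x => (g x - g e) / (x - e)) (nhdsWithin e (Iio e)) (nhds v))
    {x : ℝ} (hx : x ∈ Ioo e t₁) :
    0 < v * (x - e) / (d * g e) + 1 ∧ g x ≤ g e * (v * (x - e) / (d * g e) + 1) ^ d := by
  have hd' : (d : ℝ) ≠ 0 := Nat.cast_ne_zero.2 hd
  have hx₀ : x ∈ Ioo t₀ t₁ := ⟨he.1.trans hx.1, hx.2⟩
  have hge := hpos e he
  have hgx := hpos x hx₀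
  set f := fun x => g x ^ (d : ℝ)⁻¹ with hf
  have hslope : (fun x => (g x - g e) / (x - e)) = slope g e := by
    ext y
    rw [slope_def_field]
  rw [hslope] at hv
  set m := v * (d : ℝ)⁻¹ * g e ^ ((d : ℝ)⁻¹ - 1) with hm
  have hder : ∀ {s : Set ℝ}, e ∉ s → Tendsto (slope g e) (nhdsWithin e s) (nhds v) →
      HasDerivWithinAt f m s e := fun hs h =>
    ((hasDerivWithinAt_iff_tendsto_slope' hs).2 h).rpow_const (Or.inl hge.ne')
  have hle : slope f e x ≤ m := by
    rcases hv with h | h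
    · exact hg.slope_le_of_hasDerivWithinAt_Ioi he hx₀ hx.1 (hder self_notMem_Ioi h)
    · have ht := (hasDerivWithinAt_iff_tendsto_slope' self_notMem_Iio).1 (hder self_notMem_Iio h)
      refine ge_of_tendsto ht ?_
      filter_upwards [Ioo_mem_nhdsLT he.1] with y hy
      rw [slope_comm f e y, slope_def_field, slope_def_field]
      exact hg.slope_anti_adjacent ⟨hy.1, hy.2.trans he.2⟩ hx₀ hy.2 hx.1
  rw [slope_def_field, div_le_iff₀ (sub_pos.2 hx.1)] at hle
  have hfe : 0 < f e := Real.rpow_pos_of_pos hge _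
  have hfx : 0 < f x := Real.rpow_pos_of_pos hgx _
  have hme : m = f e * (v / (d * g e)) := by
    rw [hm, Real.rpow_sub_one hge.ne']
    simp only [hf]
    field_simp
  have hle' : f x ≤ f e * (v * (x - e) / (d * g e) + 1) := by
    have : f e * (v * (x - e) / (d * g e) + 1) = m * (x - e) + f e := by
      rw [hme]
      ring
    linarith
  have hℓ : 0 < v * (x - e) / (d * g e) + 1 := pos_of_mul_pos_right (hfx.trans_le hle') hfe.le
  refine ⟨hℓ, ?_⟩
  have hpow := pow_le_pow_left₀ hfx.le hle' d
  rw [mul_pow] at hpow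
  simp only [hf, Real.rpow_inv_natCast_pow hge.le hd, Real.rpow_inv_natCast_pow hgx.le hd] at hpow
  exact hpow

lemma integral_const_mul_affine_pow {G v e : ℝ} {d : ℕ} (hd : d ≠ 0) (hG : 0 < G) (hv : v ≠ 0)
    (s : ℝ) :
    ∫ x in e..s, G * (v * (x - e) / (d * G) + 1) ^ d =
      d * G ^ 2 / (v * (d + 1)) * ((v * (s - e) / (d * G) + 1) ^ (d + 1) - 1) := by
  have hd' : (d : ℝ) ≠ 0 := Nat.cast_ne_zero.2 hd
  have hd₁ : (d : ℝ) + 1 ≠ 0 := by positivity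
  have hder : ∀ x ∈ uIcc e s, HasDerivAt
      (fun x => d * G ^ 2 / (v * (d + 1)) * (v * (x - e) / (d * G) + 1) ^ (d + 1))
      (G * (v * (x - e) / (d * G) + 1) ^ d) x := by
    intro x _
    have h := (((((hasDerivAt_id x).sub_const e).const_mul v).div_const (d * G)).add_const
      1).pow (d + 1)
    refine (h.const_mul (d * G ^ 2 / (v * (d + 1)))).congr_deriv ?_
    simp only [id, Nat.add_sub_cancel]
    push_cast
    field_simp
  rw [intervalIntegral.integral_eq_sub_of_hasDerivAt hder
    (Continuous.intervalIntegrable (by fun_prop) _ _)]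
  simp
  ring

lemma mem_Ioc_and_integral_affine_pow_eq {G v e t₁ W s₀ : ℝ} {d : ℕ} (hd : d ≠ 0) (hG : 0 < G)
    (he : e < t₁) (hW : 0 < W) (hpos : ∀ x ∈ Ioo e t₁, 0 < v * (x - e) / (d * G) + 1)
    (hle : W ≤ ∫ x in e..t₁, G * (v * (x - e) / (d * G) + 1) ^ d)
    (hv : v ≠ 0 → s₀ = e + d * G / v *
      ((((d + 1) * v * W + d * G ^ 2) / (d * G ^ 2)) ^ ((1 : ℝ) / (d + 1)) - 1))
    (hv₀ : v = 0 → s₀ = e + 1 / G * W) :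
    s₀ ∈ Ioc e t₁ ∧ (∫ x in e..s₀, G * (v * (x - e) / (d * G) + 1) ^ d) = W ∧
      ∀ s ∈ Ioc e t₁, (∫ x in e..s, G * (v * (x - e) / (d * G) + 1) ^ d) = W → s = s₀ := by
  have hd' : (d : ℝ) ≠ 0 := Nat.cast_ne_zero.2 hd
  have hd₁ : (d : ℝ) + 1 ≠ 0 := by positivity
  have huniq : ∀ s ∈ Ioc e t₁,
      (∫ x in e..s, G * (v * (x - e) / (d * G) + 1) ^ d) = W → s = s₀ := by
    intro s hs hsW
    by_cases hv' : v = 0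
    · rw [hv₀ hv', ← hsW]
      simp only [hv', zero_mul, zero_div, zero_add, one_pow, mul_one,
        intervalIntegral.integral_const, smul_eq_mul]
      field_simp
      ring
    · have hnonneg : 0 ≤ v * (s - e) / (d * G) + 1 := by
        have hcl : IsClosed {x : ℝ | 0 ≤ v * (x - e) / (d * G) + 1} :=
          isClosed_le continuous_const (by fun_prop)
        have hsub := hcl.closure_subset_iff.2 fun x hx => (hpos x hx).le
        rw [closure_Ioo he.ne] at hsub
        exact hsub ⟨hs.1.le, hs.2⟩
      rw [integral_const_mul_affine_pow hd hG hv'] at hsW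
      have hbase : ((d + 1) * v * W + d * G ^ 2) / (d * G ^ 2) =
          (v * (s - e) / (d * G) + 1) ^ (d + 1) := by
        rw [← hsW]
        field_simp
        ring
      have hroot := Real.pow_rpow_inv_natCast hnonneg d.succ_ne_zero
      push_cast at hroot
      rw [hv hv', hbase, one_div, hroot]
      field_simp
      ring
  have hcont : Continuous fun s => ∫ x in e..s, G * (v * (x - e) / (d * G) + 1) ^ d :=
    intervalIntegral.continuous_primitive
      (fun _ _ => Continuous.intervalIntegrable (by fun_prop) _ _) e
  obtain ⟨s, hs, hsW⟩ := intermediate_value_Ioc he.le hcont.continuousOn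
    ⟨by simpa using hW, hle⟩
  obtain rfl := huniq s hs hsW
  exact ⟨hs, hsW, huniq⟩

end BrunnMinkowski

theorem stmt_2
    (n : ℕ) (hn : 2 ≤ n)
    (Δ : Set (ℝ × (Fin (n - 1) → ℝ)))
    (hΔcomp : IsCompact Δ) (hΔconv : Convex ℝ Δ)
    (hΔint : (interior Δ).Nonempty)
    (t₀ t₁ : ℝ) (hproj : Prod.fst '' Δ = Icc t₀ t₁)
    (V : ℝ) (hV : V = (volume Δ).toReal)
    (b₁ : ℝ) (hb₁ : b₁ = (1 / V) * ∫ p in Δ, p.1)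
    (g : ℝ → ℝ)
    (hg : ∀ x : ℝ, g x = (volume {y : Fin (n - 1) → ℝ | (x, y) ∈ Δ}).toReal)
    (e : ℝ) (he : e ∈ Ioo t₀ t₁)
    (v : ℝ)
    (hv : Tendsto (fun x => (g x - g e) / (x - e)) (nhdsWithin e (Ioi e)) (nhds v)
        ∨ Tendsto (fun x => (g x - g e) / (x - e)) (nhdsWithin e (Iio e)) (nhds v))
    (h₀ : ℝ → ℝ)
    (hh₀ : ∀ x ∈ Icc t₀ e, h₀ x = g x)
    (hh₀' : ∀ x ∈ Icc e t₁,
      h₀ x = g e * (v * (x - e) / (((n : ℝ) - 1) * g e) + 1) ^ (n - 1))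
    (s₀ : ℝ)
    (hs₀v : v ≠ 0 → s₀ = e + (((n : ℝ) - 1) * g e / v) *
      ((((n : ℝ) * v * (V - ∫ x in t₀..e, g x) + ((n : ℝ) - 1) * g e ^ 2) /
          (((n : ℝ) - 1) * g e ^ 2)) ^ ((1 : ℝ) / (n : ℝ)) - 1))
    (hs₀0 : v = 0 → s₀ = e + (1 / g e) * (V - ∫ x in t₀..e, g x)) :
    s₀ ∈ Ioc e t₁ ∧ (∫ x in t₀..s₀, h₀ x) = V ∧
      ∀ s ∈ Ioc e t₁, (∫ x in t₀..s, h₀ x) = V → s = s₀ := by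
  obtain ⟨d, rfl⟩ : ∃ d, n = d + 1 := ⟨n - 1, by omega⟩
  have hd : d ≠ 0 := by omega
  have h01 : t₀ ≤ t₁ := (he.1.trans he.2).le
  have hg' : g = fun x => volume.real {y : Fin d → ℝ | (x, y) ∈ Δ} := funext hg
  have hpos : ∀ x ∈ Ioo t₀ t₁, 0 < g x := fun x hx => by
    rw [hg']
    exact hΔconv.volume_section_pos hΔcomp hΔint hproj hx
  have hconc : ConcaveOn ℝ (Ioo t₀ t₁) fun x => g x ^ (d : ℝ)⁻¹ := by
    rw [hg']
    exact hΔconv.concaveOn_volume_section_rpow hΔcomp hΔint hd hproj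
  have hint : ∀ a b, IntervalIntegrable g volume a b := fun a b => by
    rw [hg']
    exact (hΔcomp.integrable_volume_section (d := d)).intervalIntegrable
  have htotal : ∫ x in t₀..t₁, g x = V := by
    rw [hg', hV]
    exact hΔcomp.integral_volume_section h01 hproj
  have hrest : V - ∫ x in t₀..e, g x = ∫ x in e..t₁, g x := by
    rw [← htotal, ← intervalIntegral.integral_add_adjacent_intervals (hint t₀ e) (hint e t₁)]
    ring
  have htan := fun x (hx : x ∈ Ioo e t₁) => hconc.le_pow_of_tendsto_slope hd he hpos hv hx
  push_cast at hs₀v hh₀'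
  simp only [add_sub_cancel_right] at hs₀v hh₀'
  have hcont : Continuous fun x => g e * (v * (x - e) / (d * g e) + 1) ^ d := by fun_prop
  obtain ⟨hmem, heq, huniq⟩ := mem_Ioc_and_integral_affine_pow_eq (W := V - ∫ x in t₀..e, g x) hd
    (hpos e he) he.2 (by
      rw [hrest]
      exact intervalIntegral.intervalIntegral_pos_of_pos_on (hint e t₁)
        (fun x hx => hpos x ⟨he.1.trans hx.1, hx.2⟩) he.2) (fun x hx => (htan x hx).1) (by
      rw [hrest]
      exact intervalIntegral.integral_mono_on_of_le_Ioo he.2.le (hint e t₁)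
        (hcont.intervalIntegrable _ _) fun x hx => (htan x hx).2) hs₀v hs₀0
  have hh : ∀ s ∈ Ioc e t₁, ∫ x in t₀..s, h₀ x = (∫ x in t₀..e, g x) +
      ∫ x in e..s, g e * (v * (x - e) / (d * g e) + 1) ^ d := by
    intro s hs
    have h₁ : EqOn g h₀ (uIcc t₀ e) := fun x hx => by
      rw [uIcc_of_le he.1.le] at hx
      exact (hh₀ x hx).symm
    have h₂ : EqOn (fun x => g e * (v * (x - e) / (d * g e) + 1) ^ d) h₀ (uIcc e s) :=
      fun x hx => by
        rw [uIcc_of_le hs.1.le] at hx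
        exact (hh₀' x ⟨hx.1, hx.2.trans hs.2⟩).symm
    rw [intervalIntegral.integral_congr h₁, intervalIntegral.integral_congr h₂,
      intervalIntegral.integral_add_adjacent_intervals
        ((hint t₀ e).congr (h₁.mono uIoc_subset_uIcc))
        ((hcont.intervalIntegrable e s).congr (h₂.mono uIoc_subset_uIcc))]
  refine ⟨hmem, by rw [hh s₀ hmem, heq]; ring, fun s hs hsV => huniq s hs ?_⟩
  rw [← hsV, hh s hs]
  ring
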